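/- Let c be a finitely supported real-valued function on nonempty finite lists of nonzero integers, and define S(n) = Σ_a c(a)·S_a(n), the corresponding finite linear combination of nested harmonic sums. Then S(2n+1) = S(2n+2) for every natural number n if and only if c((a)⌢b) = − c((−a)⌢b) for every nonzero integer a and every (possibly empty) list b of nonzero integers. -/

import Mathlib

/-- Nested (signed) harmonic sum `S_{a₁,…,a_ℓ}(N)`,
`S_{a₁,…,a_ℓ}(N) = Σ_{n=1}^{N} (sign a₁)^n / n^{|a₁|} · S_{a₂,…,a_ℓ}(n)`, with `S_{}(n) = 1`. -/
noncomputable def nestedS : List ℤ → ℕ → ℝ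
  | [], _ => 1
  | a :: b, N => ∑ n ∈ Finset.Icc 1 N, ((Int.sign a : ℝ)) ^ n / (n : ℝ) ^ a.natAbs * nestedS b n

section Words

open Finsupp

variable {L K : Type*} [Field K]

/-- The `σ`-semilinear extension to `List L →₀ K` of a map `e` given on the basis of words. -/
noncomputable def twist (σ : K →+* K) (e : List L → List L →₀ K) (f : List L →₀ K) :
    List L →₀ K :=
  f.sum fun b r => σ r • e b

/-- The coefficients at the words `a :: v`, as a function of the letter `a`. -/
noncomputable def consCoeff (f : List L →₀ K) (v : List L) : L →₀ K :=
  f.comapDomain (· :: v) fun _ _ _ _ h => (List.cons.inj h).1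

@[simp]
theorem consCoeff_apply (f : List L →₀ K) (v : List L) (a : L) : consCoeff f v a = f (a :: v) :=
  rfl

theorem twist_apply {σ : K →+* K} {α : L → K} {e : List L → List L →₀ K}
    (he : ∀ b v, b.length ≤ v.length → e b v = single b 1 v)
    (he' : ∀ a b v, b.length = v.length → e (a :: b) v = single b (α a) v)
    {f : List L →₀ K} {v : List L} (hf : ∀ b ∈ f.support, b.length ≤ v.length + 1) :
    twist σ e f v = σ (f v) + (consCoeff f v).sum fun a r => σ r * α a := by
  classical
  have hv : v ∉ (consCoeff f v).support.image (· :: v) := by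
    simp only [Finset.mem_image, not_exists, not_and]
    intro a _ h
    simpa using congrArg List.length h
  have hsum : ∑ b ∈ insert v ((consCoeff f v).support.image (· :: v)), σ (f b) * e b v =
      σ (f v) + (consCoeff f v).sum fun a r => σ r * α a := by
    rw [Finset.sum_insert hv, Finset.sum_image fun _ _ _ _ h => (List.cons.inj h).1, he v v le_rfl,
      single_eq_same, mul_one, Finsupp.sum]
    refine congrArg _ (Finset.sum_congr rfl fun a _ => ?_)
    rw [he' a v v rfl, single_eq_same, consCoeff_apply]
  rw [← hsum, twist, Finsupp.sum, Finsupp.finsetSum_apply]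
  simp only [Finsupp.smul_apply, smul_eq_mul]
  refine Finset.sum_congr_of_eq_on_inter (fun b hb hbS => ?_) (fun b _ hb => ?_)
    (fun b _ _ => rfl)
  · rcases (hf b hb).lt_or_eq with h | h
    · rw [he b v (by omega), single_eq_of_ne (fun h => hbS (by simp [h])), mul_zero]
    · obtain _ | ⟨a, b⟩ := b
      · simp at h
      · rw [he' a b v (by simpa using h), single_eq_of_ne, mul_zero]
        rintro rfl
        exact hbS (Finset.mem_insert_of_mem (Finset.mem_image_of_mem _ (by simpa using hb)))
  · rw [Finsupp.notMem_support_iff.1 hb, map_zero, zero_mul]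

theorem twist_apply_of_length_le {σ : K →+* K} {α : L → K} {e : List L → List L →₀ K}
    (he : ∀ b v, b.length ≤ v.length → e b v = single b 1 v)
    (he' : ∀ a b v, b.length = v.length → e (a :: b) v = single b (α a) v)
    {f : List L →₀ K} {v : List L} (hf : ∀ b ∈ f.support, b.length ≤ v.length) :
    twist σ e f v = σ (f v) := by
  rw [twist_apply he he' fun b hb => (hf b hb).trans (Nat.le_succ _)]
  have : consCoeff f v = 0 := by
    ext a
    by_contra h
    simpa using hf _ (Finsupp.mem_support_iff.2 h)
  simp [this]

/-- A space of relations that is stable under a unipotent twist and does not contain the empty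
word is trivial, provided that no nontrivial combination of the `α a` with `σ`-invariant
coefficients is a difference `σ h - h`. -/
theorem eq_zero_of_twist_mem {σ : K →+* K} {α : L → K} {e : List L → List L →₀ K}
    (he : ∀ b v, b.length ≤ v.length → e b v = single b 1 v)
    (he' : ∀ a b v, b.length = v.length → e (a :: b) v = single b (α a) v)
    (hα : ∀ (v : L →₀ K) (h : K), (∀ a, σ (v a) = v a) →
      σ h + (v.sum fun a r => r * α a) = h → v = 0)
    {R : Submodule K (List L →₀ K)} (hR : ∀ f ∈ R, twist σ e f ∈ R) (hnil : single [] 1 ∉ R)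
    {f : List L →₀ K} (hf : f ∈ R) : f = 0 := by
  classical
  suffices H : ∀ (l : ℕ), ∀ f ∈ R, (∀ b ∈ f.support, b.length ≤ l) → f = 0 from
    H (f.support.sup List.length) f hf fun b hb => Finset.le_sup hb
  intro l
  induction l with
  | zero =>
    intro f hf hl
    have hfe : f = f [] • single [] 1 := by
      ext b
      by_cases hb : b = []
      · simp [hb]
      · rw [Finsupp.smul_apply, single_eq_of_ne hb, smul_zero]
        by_contra h
        exact hb (List.length_eq_zero_iff.1 (Nat.le_zero.1 (hl b (Finsupp.mem_support_iff.2 h))))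
    by_contra h0
    have h1 : f [] ≠ 0 := fun h => h0 (by rw [hfe, h, zero_smul])
    exact hnil ((R.smul_mem_iff h1).1 (hfe ▸ hf))
  | succ l ih =>
    intro f hf hl
    induction hn : (f.support.filter (·.length = l + 1)).card using Nat.strong_induction_on
      generalizing f with
    | _ n ihn =>
      subst hn
      by_contra h0
      obtain ⟨w, hw, hwl⟩ : ∃ w ∈ f.support, w.length = l + 1 := by
        by_contra! h
        exact h0 (ih f hf fun b hb => by have := hl b hb; have := h b hb; omega)
      set g := (f w)⁻¹ • f with hg
      have hw0 : f w ≠ 0 := Finsupp.mem_support_iff.1 hw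
      have hgR : g ∈ R := R.smul_mem _ hf
      have hgsupp : g.support = f.support :=
        Finsupp.support_smul_eq (inv_ne_zero hw0)
      have hgw : g w = 1 := by simp [hg, hw0]
      have hgl : ∀ b ∈ g.support, b.length ≤ l + 1 := hgsupp ▸ hl
      have htop : ∀ b, l + 1 ≤ b.length → twist σ e g b = σ (g b) := fun b hb =>
        twist_apply_of_length_le he he' fun b' hb' => (hgl b' hb').trans hb
      have hbig : ∀ b ∈ (twist σ e g - g).support, b ∈ f.support ∨ b.length ≤ l := by
        intro b hb
        by_contra! h
        rw [Finsupp.mem_support_iff, Finsupp.sub_apply, htop b h.2,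
          Finsupp.notMem_support_iff.1 (hgsupp ▸ h.1)] at hb
        simp at hb
      have hfix : twist σ e g - g = 0 := by
        refine ihn _ (Finset.card_lt_card ?_) _ (R.sub_mem (hR g hgR) hgR) (fun b hb => ?_) rfl
        · refine Finset.ssubset_iff_of_subset (fun b hb => ?_) |>.2 ⟨w, by simp [hw0, hwl], ?_⟩
          · rw [Finset.mem_filter] at hb ⊢
            exact ⟨(hbig b hb.1).resolve_right (by omega), hb.2⟩
          · simp [htop w hwl.ge, hgw]
        · rcases hbig b hb with h | h
          · exact hl b h
          · omega
      have hfix' : ∀ b, twist σ e g b = g b := fun b => by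
        rw [← sub_eq_zero, ← Finsupp.sub_apply, hfix, Finsupp.zero_apply]
      obtain _ | ⟨a, u⟩ := w
      · simp at hwl
      have hul : u.length = l := by simpa using hwl
      have hinv : ∀ a', σ (consCoeff g u a') = consCoeff g u a' := fun a' => by
        rw [consCoeff_apply, ← htop _ (by simp [hul]), hfix']
      have hu := hfix' u
      rw [twist_apply he he' (by rwa [hul])] at hu
      have := hα (consCoeff g u) (g u) hinv
        (by simpa only [Finsupp.sum, hinv] using hu)
      have h1 := DFunLike.congr_fun this a
      rw [consCoeff_apply, hgw] at h1
      exact one_ne_zero h1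

end Words

section RationalFunctions

open Polynomial

/-- The substitution `x ↦ x - t` on rational functions. -/
noncomputable def ratShift (t : ℝ) : RatFunc ℝ →+* RatFunc ℝ :=
  RatFunc.mapRingHom (compRingHom (X - C t))
    (nonZeroDivisors_le_comap_nonZeroDivisors_of_injective _ fun p q h =>
      taylor_injective (-t) (by simpa [taylor_apply, sub_eq_add_neg] using h))

theorem ratShift_algebraMap (t : ℝ) (p : ℝ[X]) :
    ratShift t (algebraMap _ _ p) = algebraMap _ _ (p.comp (X - C t)) := by
  have := RatFunc.map_apply_div (R := ℝ) (compRingHom (X - C t))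
    (nonZeroDivisors_le_comap_nonZeroDivisors_of_injective _ fun p q h =>
      taylor_injective (-t) (by simpa [taylor_apply, sub_eq_add_neg] using h)) p 1
  simpa [ratShift, RatFunc.coe_mapRingHom_eq_coe_map] using this

theorem ratShift_neg_ratShift (t : ℝ) (r : RatFunc ℝ) : ratShift (-t) (ratShift t r) = r := by
  rw [← RatFunc.num_div_denom r]
  simp only [map_div₀, ratShift_algebraMap, comp_assoc]
  simp

/-- The rational functions without a pole at `x`. -/
noncomputable def regularAt (x : ℝ) : Subalgebra ℝ (RatFunc ℝ) where
  carrier := {r | r.denom.eval x ≠ 0}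
  mul_mem' {r s} hr hs h := by
    have := eval_eq_zero_of_dvd_of_eval_eq_zero (RatFunc.denom_mul_dvd r s) h
    rw [eval_mul] at this
    exact (mul_ne_zero hr hs) this
  add_mem' {r s} hr hs h := by
    have := eval_eq_zero_of_dvd_of_eval_eq_zero (RatFunc.denom_add_dvd r s) h
    rw [eval_mul] at this
    exact (mul_ne_zero hr hs) this
  algebraMap_mem' c := by
    rw [IsScalarTower.algebraMap_apply ℝ ℝ[X] (RatFunc ℝ)]
    simp

theorem mem_regularAt {x : ℝ} {r : RatFunc ℝ} : r ∈ regularAt x ↔ r.denom.eval x ≠ 0 :=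
  Iff.rfl

theorem div_mem_regularAt {x : ℝ} (p : ℝ[X]) {q : ℝ[X]} (hq : q.eval x ≠ 0) :
    algebraMap _ _ p / algebraMap _ _ q ∈ regularAt x := fun h =>
  hq (eval_eq_zero_of_dvd_of_eval_eq_zero (RatFunc.denom_div_dvd p q) h)

theorem finite_notMem_regularAt (r : RatFunc ℝ) : {x | r ∉ regularAt x}.Finite := by
  refine (r.denom.roots.toFinset.finite_toSet).subset fun x hx => ?_
  simpa [mem_regularAt, RatFunc.denom_ne_zero] using hx

theorem ratShift_mem_regularAt_of_mem {t x : ℝ} {r : RatFunc ℝ} (hr : r ∈ regularAt (x - t)) :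
    ratShift t r ∈ regularAt x := by
  rw [← RatFunc.num_div_denom r, map_div₀, ratShift_algebraMap, ratShift_algebraMap]
  exact div_mem_regularAt _ (by simpa [mem_regularAt] using hr)

theorem ratShift_mem_regularAt {t x : ℝ} {r : RatFunc ℝ} :
    ratShift t r ∈ regularAt x ↔ r ∈ regularAt (x - t) := by
  refine ⟨fun h => ?_, ratShift_mem_regularAt_of_mem⟩
  rw [← ratShift_neg_ratShift t r]
  exact ratShift_mem_regularAt_of_mem (by simpa using h)

/-- A difference `r(x - t) - r(x)` cannot have exactly one pole in a class modulo `t`. -/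
theorem ratShift_sub_mem_regularAt {t : ℝ} (ht : t ≠ 0) {x : ℝ} {r : RatFunc ℝ}
    (h : ∀ m : ℤ, m ≠ 0 → ratShift t r - r ∈ regularAt (x + m * t)) :
    ratShift t r - r ∈ regularAt x := by
  set P : Set ℤ := {m | r ∉ regularAt (x + m * t)} with hP
  have hfin : P.Finite := (finite_notMem_regularAt r).preimage
    (f := fun m : ℤ => x + m * t) fun a _ b _ hab => by simpa [ht] using hab
  have hshift : ∀ m : ℤ, ratShift t r ∈ regularAt (x + m * t) ↔ m - 1 ∉ P := fun m => by
    rw [ratShift_mem_regularAt, hP, Set.mem_ofPred_eq, not_not]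
    push_cast
    ring_nf
  have hmem : ∀ m : ℤ, r ∈ regularAt (x + m * t) ↔ m ∉ P := fun m => by simp [hP]
  have hstep : ∀ m : ℤ, m ≠ 0 → (m - 1 ∈ P ↔ m ∈ P) := fun m hm => by
    rw [← not_iff_not, ← hshift, ← hmem]
    exact ⟨fun h' => by simpa using sub_mem h' (h m hm), fun h' => by simpa using add_mem (h m hm) h'⟩
  have hempty : P = ∅ := by
    by_contra! hne
    obtain ⟨M, hM, hMax⟩ := hfin.exists_maximal hne
    obtain ⟨m, hm, hMin⟩ := hfin.exists_minimal hne
    have h1 : M + 1 = 0 := by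
      by_contra h0
      have := hMax ((hstep _ h0).1 (by simpa using hM)) (by omega)
      omega
    have h2 : m = 0 := by
      by_contra h0
      have := hMin ((hstep _ h0).2 hm) (by omega)
      omega
    have := hMax hm (by omega)
    omega
  have h0 := (hmem 0).2 (by simp [hempty])
  have h0' := (hshift 0).2 (by simp [hempty])
  simpa using sub_mem h0' h0

/-- The rational function `(x - y)⁻¹`. -/
noncomputable def simplePole (y : ℝ) : RatFunc ℝ :=
  (algebraMap ℝ[X] (RatFunc ℝ) (X - C y))⁻¹

theorem simplePole_mem_regularAt {x y : ℝ} (h : x ≠ y) : simplePole y ∈ regularAt x := by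
  have := div_mem_regularAt (x := x) 1 (q := X - C y) (by simpa [sub_eq_zero] using h)
  simpa [simplePole] using this

theorem aeval_mem_of_mem {S : Subalgebra ℝ (RatFunc ℝ)} {r : RatFunc ℝ} (hr : r ∈ S) (A : ℝ[X]) :
    aeval r A ∈ S :=
  Algebra.adjoin_le (Set.singleton_subset_iff.2 hr) (aeval_mem_adjoin_singleton ℝ r)

/-- A polynomial without constant term in `(x - y)⁻¹` that has no pole at `y` vanishes. -/
theorem eq_zero_of_aeval_simplePole_mem {y : ℝ} {A : ℝ[X]} (h0 : A.coeff 0 = 0)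
    (hA : aeval (simplePole y) A ∈ regularAt y) : A = 0 := by
  by_contra hne
  have hdeg : A.natDegree ≠ 0 := fun h => hne (by rw [eq_C_of_natDegree_eq_zero h, h0, C_0])
  set r := aeval (simplePole y) A with hr
  have hXy : algebraMap ℝ[X] (RatFunc ℝ) (X - C y) ≠ 0 :=
    RatFunc.algebraMap_ne_zero (X_sub_C_ne_zero y)
  have hrev : algebraMap ℝ[X] (RatFunc ℝ) (A.reverse.comp (X - C y)) =
      r * algebraMap ℝ[X] (RatFunc ℝ) (X - C y) ^ A.natDegree := by
    let : Invertible (simplePole y) := invertibleOfNonzero (inv_ne_zero hXy)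
    have h := eval₂_reverse_mul_pow (algebraMap ℝ (RatFunc ℝ)) (simplePole y) A
    rw [hr, aeval_def, ← h, mul_assoc, ← mul_pow, invOf_eq_inv, simplePole, inv_mul_cancel₀ hXy,
      one_pow, mul_one, inv_inv, comp, hom_eval₂]
    rfl
  have hpoly : A.reverse.comp (X - C y) * r.denom = r.num * (X - C y) ^ A.natDegree := by
    apply RatFunc.algebraMap_injective ℝ
    rw [map_mul, hrev, map_mul, map_pow]
    nth_rewrite 1 [← RatFunc.num_div_denom r]
    have := RatFunc.algebraMap_ne_zero (RatFunc.denom_ne_zero r)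
    field_simp
  have := congrArg (eval y) hpoly
  simp only [eval_mul, eval_comp, eval_sub, eval_X, eval_C, sub_self, eval_pow, zero_pow hdeg,
    mul_zero, ← coeff_zero_eq_eval_zero, coeff_zero_reverse, mul_eq_zero, leadingCoeff_eq_zero]
    at this
  exact this.elim hne hA

end RationalFunctions

section Germs

open Polynomial Filter

/-- Germs at infinity of real sequences; a sequence records values at the even numbers `2 * n`. -/
abbrev SeqGerm : Type := (atTop : Filter ℕ).Germ ℝ

/-- The germ of `n ↦ p (2 * n)`. -/
noncomputable def polyGerm : ℝ[X] →+* SeqGerm :=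
  (Germ.coeRingHom atTop).comp (RingHom.pi fun n : ℕ => evalRingHom (2 * n : ℝ))

theorem polyGerm_apply (p : ℝ[X]) :
    polyGerm p = ((fun n : ℕ => p.eval (2 * n : ℝ) : ℕ → ℝ) : SeqGerm) :=
  rfl

theorem germ_mul_eq_one {f g : ℕ → ℝ} (h : ∀ᶠ n in atTop, f n * g n = 1) :
    (f : SeqGerm) * (g : SeqGerm) = 1 := by
  rw [← Germ.coe_mul, ← Germ.coe_one, Germ.coe_eq]
  exact h

theorem isUnit_polyGerm {p : ℝ[X]} (hp : p ≠ 0) : IsUnit (polyGerm p) := by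
  have h : ∀ᶠ n : ℕ in atTop, ¬ p.IsRoot (2 * n : ℝ) :=
    (tendsto_natCast_atTop_atTop.const_mul_atTop two_pos).eventually (eventually_atTop_not_isRoot p hp)
  refine IsUnit.of_mul_eq_one _ (germ_mul_eq_one (g := fun n : ℕ => (p.eval (2 * n : ℝ))⁻¹) ?_)
  filter_upwards [h] with n hn using mul_inv_cancel₀ hn

/-- The germ of `n ↦ r (2 * n)`. -/
noncomputable def ratGerm : RatFunc ℝ →+* SeqGerm :=
  IsLocalization.lift (M := nonZeroDivisors ℝ[X]) (g := polyGerm) fun y =>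
    isUnit_polyGerm (nonZeroDivisors.ne_zero y.2)

theorem ratGerm_algebraMap (p : ℝ[X]) : ratGerm (algebraMap _ _ p) = polyGerm p :=
  IsLocalization.lift_eq _ p

theorem ratGerm_algebraMap_real (c : ℝ) :
    ratGerm (algebraMap ℝ _ c) = ((fun _ => c : ℕ → ℝ) : SeqGerm) := by
  rw [IsScalarTower.algebraMap_apply ℝ ℝ[X] (RatFunc ℝ), ratGerm_algebraMap, polyGerm_apply]
  simp

theorem ratGerm_simplePole (y : ℝ) :
    ratGerm (simplePole y) = ((fun n : ℕ => (2 * n - y : ℝ)⁻¹ : ℕ → ℝ) : SeqGerm) := by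
  have h : ∀ᶠ n : ℕ in atTop, y < 2 * n :=
    (tendsto_natCast_atTop_atTop.const_mul_atTop two_pos).eventually_gt_atTop y
  refine left_inv_eq_right_inv (a := polyGerm (X - C y)) ?_
    (germ_mul_eq_one (f := fun n : ℕ => (X - C y).eval (2 * n : ℝ)) ?_)
  · rw [← ratGerm_algebraMap, ← map_mul, simplePole, inv_mul_cancel₀, map_one]
    exact RatFunc.algebraMap_ne_zero (X_sub_C_ne_zero y)
  · filter_upwards [h] with n hn
    rw [eval_sub, eval_X, eval_C, mul_inv_cancel₀ (sub_pos.2 hn).ne']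

/-- The shift `n ↦ n - 1` on germs. -/
noncomputable def germShift : SeqGerm →+* SeqGerm where
  toFun f := f.compTendsto (fun n => n - 1) (tendsto_sub_atTop_nat 1)
  map_one' := rfl
  map_zero' := rfl
  map_mul' f g := Germ.inductionOn₂ f g fun _ _ => rfl
  map_add' f g := Germ.inductionOn₂ f g fun _ _ => rfl

theorem germShift_coe (f : ℕ → ℝ) :
    germShift (f : SeqGerm) = ((fun n => f (n - 1) : ℕ → ℝ) : SeqGerm) :=
  rfl

theorem ratGerm_ratShift (r : RatFunc ℝ) : ratGerm (ratShift 2 r) = germShift (ratGerm r) := by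
  suffices ratGerm.comp (ratShift 2) = germShift.comp ratGerm from DFunLike.congr_fun this r
  refine IsLocalization.ringHom_ext (nonZeroDivisors ℝ[X]) (RingHom.ext fun p => ?_)
  simp only [RingHom.comp_apply, ratShift_algebraMap, ratGerm_algebraMap, polyGerm_apply,
    germShift_coe, Germ.coe_eq]
  filter_upwards [eventually_ge_atTop 1] with n hn
  simp [Nat.cast_sub hn, mul_sub]

theorem exists_eq_algebraMap_of_ratShift_eq {r : RatFunc ℝ} (h : ratShift 2 r = r) :
    ∃ c : ℝ, algebraMap ℝ _ c = r := by
  obtain ⟨f, hf⟩ : ∃ f : ℕ → ℝ, (f : SeqGerm) = ratGerm r := Quotient.exists_rep _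
  have hfix : germShift (ratGerm r) = ratGerm r := by rw [← ratGerm_ratShift, h]
  rw [← hf, germShift_coe, Germ.coe_eq] at hfix
  obtain ⟨N, hN⟩ := eventually_atTop.1 hfix
  refine ⟨f N, ratGerm.injective ?_⟩
  rw [ratGerm_algebraMap_real, ← hf, Germ.coe_eq]
  filter_upwards [eventually_ge_atTop N] with n hn
  induction n, hn using Nat.le_induction with
  | base => rfl
  | succ n hn ih => exact ih.trans (hN (n + 1) (by omega))

end Germs

section NestedSums

open Polynomial Filter

/-- The coefficient of `S_b(N)` in the expansion of `S_{a⌢b}(N - 2)` for even `N`. -/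
noncomputable def letterCoeff (a : ℤ) : RatFunc ℝ :=
  -(simplePole 0 ^ a.natAbs + (a.sign : RatFunc ℝ) * simplePole 1 ^ a.natAbs)

/-- The polynomial `Σ_a v(a) g(a) X^|a|`. -/
noncomputable def letterPoly (g : ℤ → ℝ) (v : {a : ℤ // a ≠ 0} →₀ ℝ) : ℝ[X] :=
  v.sum fun a r => C (r * g a) * X ^ a.1.natAbs

theorem coeff_zero_letterPoly (g : ℤ → ℝ) (v : {a : ℤ // a ≠ 0} →₀ ℝ) :
    (letterPoly g v).coeff 0 = 0 := by
  rw [letterPoly, Finsupp.sum, finsetSum_coeff]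
  refine Finset.sum_eq_zero fun a _ => ?_
  rw [coeff_C_mul, coeff_X_pow, if_neg (Int.natAbs_ne_zero.2 a.2).symm, mul_zero]

theorem coeff_natAbs_letterPoly (g : ℤ → ℝ) (v : {a : ℤ // a ≠ 0} →₀ ℝ) {a : ℤ} (ha : a ≠ 0) :
    (letterPoly g v).coeff a.natAbs =
      v ⟨a, ha⟩ * g a + v ⟨-a, neg_ne_zero.2 ha⟩ * g (-a) := by
  classical
  have hne : (⟨a, ha⟩ : {a : ℤ // a ≠ 0}) ≠ ⟨-a, neg_ne_zero.2 ha⟩ := fun h => by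
    have := congrArg Subtype.val h
    dsimp only at this
    omega
  have hpair := Finset.sum_pair hne (f := fun b => v b * g b.1)
  dsimp only at hpair
  rw [letterPoly, Finsupp.sum, finsetSum_coeff, ← hpair]
  simp only [coeff_C_mul, coeff_X_pow]
  refine Finset.sum_congr_of_eq_on_inter (fun b _ hb => ?_) (fun b _ hb => ?_) fun b _ hb => ?_
  · rw [if_neg, mul_zero]
    simp only [Finset.mem_insert, Finset.mem_singleton, Subtype.ext_iff] at hb
    omega
  · rw [Finsupp.notMem_support_iff.1 hb, zero_mul]
  · rw [if_pos, mul_one]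
    simp only [Finset.mem_insert, Finset.mem_singleton, Subtype.ext_iff] at hb
    omega

theorem eq_zero_of_ratShift_add_sum_eq {v : {a : ℤ // a ≠ 0} →₀ RatFunc ℝ} {h : RatFunc ℝ}
    (hv : ∀ a, ratShift 2 (v a) = v a)
    (hsum : ratShift 2 h + (v.sum fun a r => r * letterCoeff a) = h) : v = 0 := by
  choose w hw using fun a => exists_eq_algebraMap_of_ratShift_eq (hv a)
  obtain ⟨u, hu⟩ : ∃ u : {a : ℤ // a ≠ 0} →₀ ℝ, v = u.mapRange (algebraMap ℝ _) (map_zero _) := by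
    refine ⟨Finsupp.onFinset v.support w fun a ha => ?_, ?_⟩
    · rwa [Finsupp.mem_support_iff, ← hw, Ne, map_eq_zero]
    · ext a
      simp only [Finsupp.mapRange_apply, Finsupp.onFinset_apply, hw]
  set A : ℝ[X] := letterPoly (fun _ => 1) u with hA
  set B : ℝ[X] := letterPoly (fun a => a.sign) u with hB
  have key : ratShift 2 h - h = aeval (simplePole 0) A + aeval (simplePole 1) B := by
    have hneg : aeval (simplePole 0) A + aeval (simplePole 1) B =
        -(v.sum fun a r => r * letterCoeff a) := by
      rw [hu, Finsupp.sum_mapRange_index (fun _ => zero_mul _), hA, hB, letterPoly, letterPoly]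
      simp only [Finsupp.sum, map_sum, ← Finset.sum_add_distrib, ← Finset.sum_neg_distrib]
      refine Finset.sum_congr rfl fun a _ => ?_
      simp only [map_mul, map_pow, aeval_X, aeval_C, map_one, map_intCast, letterCoeff]
      ring
    rw [hneg]
    nth_rewrite 2 [← hsum]
    ring
  have regA : ∀ x : ℝ, x ≠ 0 → aeval (simplePole 0) A ∈ regularAt x := fun x hx =>
    aeval_mem_of_mem (simplePole_mem_regularAt hx) A
  have regB : ∀ x : ℝ, x ≠ 1 → aeval (simplePole 1) B ∈ regularAt x := fun x hx =>
    aeval_mem_of_mem (simplePole_mem_regularAt hx) B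
  have hA0 : A = 0 := by
    refine eq_zero_of_aeval_simplePole_mem (y := 0) (coeff_zero_letterPoly _ _) ?_
    have := ratShift_sub_mem_regularAt (t := 2) (x := 0) (r := h) two_ne_zero fun m hm => by
      rw [key]
      refine add_mem (regA _ (by simpa using hm)) (regB _ fun h => ?_)
      have : 0 + m * 2 = (1 : ℤ) := by exact_mod_cast h
      omega
    rw [key] at this
    simpa using sub_mem this (regB 0 zero_ne_one)
  have hB0 : B = 0 := by
    refine eq_zero_of_aeval_simplePole_mem (y := 1) (coeff_zero_letterPoly _ _) ?_
    have := ratShift_sub_mem_regularAt (t := 2) (x := 1) (r := h) two_ne_zero fun m hm => by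
      rw [key]
      refine add_mem (regA _ fun h => ?_) (regB _ (by simpa using hm))
      have : 1 + m * 2 = (0 : ℤ) := by exact_mod_cast h
      omega
    rw [key] at this
    simpa using sub_mem this (regA 1 one_ne_zero)
  have hu0 : u = 0 := by
    ext ⟨a, ha⟩
    have h1 := coeff_natAbs_letterPoly (fun _ => 1) u ha
    have h2 := coeff_natAbs_letterPoly (fun a => a.sign) u ha
    rw [← hA, hA0] at h1
    rw [← hB, hB0] at h2
    simp only [coeff_zero, Int.sign_neg, Int.cast_neg] at h1 h2
    rw [Finsupp.zero_apply]
    rcases lt_or_gt_of_ne ha with h | h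
    · rw [Int.sign_eq_neg_one_of_neg h] at h2
      push_cast at h2
      linarith
    · rw [Int.sign_eq_one_of_pos h] at h2
      push_cast at h2
      linarith
  rw [hu, hu0, Finsupp.mapRange_zero]

/-- The coefficient of `S_b(N)` in the expansion of `S_{a,a'⌢b}(N - 2)` for even `N`. -/
noncomputable def letterPairCoeff (a a' : ℤ) : RatFunc ℝ :=
  (a.sign : RatFunc ℝ) * simplePole 1 ^ a.natAbs * simplePole 0 ^ a'.natAbs

/-- The expansion of `S_b(N - 2)` in terms of nested sums at `N`, for even `N`. -/
noncomputable def shiftedWord :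
    List {a : ℤ // a ≠ 0} → List {a : ℤ // a ≠ 0} →₀ RatFunc ℝ
  | [] => Finsupp.single [] 1
  | [a] => Finsupp.single [a] 1 + Finsupp.single [] (letterCoeff a)
  | a :: a' :: b => Finsupp.single (a :: a' :: b) 1 + Finsupp.single (a' :: b) (letterCoeff a) +
      Finsupp.single b (letterPairCoeff a a')

theorem shiftedWord_apply_of_length_le (b v : List {a : ℤ // a ≠ 0})
    (h : b.length ≤ v.length) : shiftedWord b v = Finsupp.single b 1 v := by
  obtain _ | ⟨a, _ | ⟨a', b⟩⟩ := b
  · rfl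
  · have h1 : v ≠ [] := by rintro rfl; simp at h
    simp [shiftedWord, Finsupp.single_eq_of_ne h1]
  · have h1 : v ≠ a' :: b := by rintro rfl; simp at h
    have h2 : v ≠ b := by rintro rfl; simp at h
    simp [shiftedWord, Finsupp.single_eq_of_ne h1, Finsupp.single_eq_of_ne h2]

theorem shiftedWord_cons_apply_of_length_eq (a : {a : ℤ // a ≠ 0}) (b v : List {a : ℤ // a ≠ 0})
    (h : b.length = v.length) :
    shiftedWord (a :: b) v = Finsupp.single b (letterCoeff a) v := by
  have h0 : v ≠ a :: b := by rintro rfl; simp at h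
  obtain _ | ⟨a', b⟩ := b
  · simp [shiftedWord, Finsupp.single_eq_of_ne h0]
  · have h2 : v ≠ b := by rintro rfl; simp at h
    simp [shiftedWord, Finsupp.single_eq_of_ne h0, Finsupp.single_eq_of_ne h2]

theorem sign_sq_eq_one {a : ℤ} (ha : a ≠ 0) : (a.sign : ℝ) ^ 2 = 1 := by
  rcases lt_or_gt_of_ne ha with h | h
  · simp [Int.sign_eq_neg_one_of_neg h]
  · simp [Int.sign_eq_one_of_pos h]

theorem nestedS_cons_succ (a : ℤ) (b : List ℤ) (N : ℕ) :
    nestedS (a :: b) (N + 1) = nestedS (a :: b) N +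
      (a.sign : ℝ) ^ (N + 1) * ((N + 1 : ℝ)⁻¹) ^ a.natAbs * nestedS b (N + 1) := by
  rw [nestedS, nestedS, Finset.sum_Icc_succ_top (by omega), div_eq_mul_inv, inv_pow]
  push_cast
  rfl

theorem nestedS_cons_even {a : ℤ} (ha : a ≠ 0) (b : List ℤ) (n : ℕ) :
    nestedS (a :: b) (2 * n + 2) = nestedS (a :: b) (2 * n + 1) +
      ((2 * n + 2 : ℝ)⁻¹) ^ a.natAbs * nestedS b (2 * n + 2) := by
  rw [nestedS_cons_succ, show 2 * n + 1 + 1 = 2 * (n + 1) by ring, pow_mul, sign_sq_eq_one ha]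
  push_cast
  ring_nf

theorem nestedS_cons_odd {a : ℤ} (ha : a ≠ 0) (b : List ℤ) (n : ℕ) :
    nestedS (a :: b) (2 * n + 1) = nestedS (a :: b) (2 * n) +
      a.sign * ((2 * n + 1 : ℝ)⁻¹) ^ a.natAbs * nestedS b (2 * n + 1) := by
  rw [nestedS_cons_succ, pow_succ, pow_mul, sign_sq_eq_one ha, one_pow, one_mul]
  push_cast
  rfl

/-- The germ of `n ↦ S_b(2n)`. -/
noncomputable def wordGerm (b : List {a : ℤ // a ≠ 0}) : SeqGerm :=
  ((fun n => nestedS (b.map (↑)) (2 * n) : ℕ → ℝ) : SeqGerm)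

/-- The germ of `n ↦ Σ_b f_b(2n) S_b(2n)`. -/
noncomputable def combGerm : (List {a : ℤ // a ≠ 0} →₀ RatFunc ℝ) →+ SeqGerm :=
  Finsupp.liftAddHom fun b => (AddMonoidHom.mulRight (wordGerm b)).comp ratGerm.toAddMonoidHom

theorem combGerm_single (b : List {a : ℤ // a ≠ 0}) (r : RatFunc ℝ) :
    combGerm (Finsupp.single b r) = ratGerm r * wordGerm b := by
  simp [combGerm]

theorem combGerm_smul (r : RatFunc ℝ) (f : List {a : ℤ // a ≠ 0} →₀ RatFunc ℝ) :
    combGerm (r • f) = ratGerm r * combGerm f := by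
  induction f using Finsupp.induction_linear with
  | zero => simp
  | add f g hf hg => rw [smul_add, map_add, hf, hg, map_add, mul_add]
  | single b s => rw [Finsupp.smul_single, combGerm_single, combGerm_single, smul_eq_mul, map_mul,
      mul_assoc]

theorem ratGerm_letterCoeff (a : ℤ) : ratGerm (letterCoeff a) =
    ((fun n : ℕ => -(((2 * n - 0 : ℝ)⁻¹) ^ a.natAbs + a.sign * ((2 * n - 1 : ℝ)⁻¹) ^ a.natAbs) :
      ℕ → ℝ) : SeqGerm) := by
  rw [letterCoeff, map_neg, map_add, map_mul, map_pow, map_pow, ratGerm_simplePole,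
    ratGerm_simplePole, map_intCast]
  rfl

theorem ratGerm_letterPairCoeff (a a' : ℤ) : ratGerm (letterPairCoeff a a') =
    ((fun n : ℕ => a.sign * ((2 * n - 1 : ℝ)⁻¹) ^ a.natAbs * ((2 * n - 0 : ℝ)⁻¹) ^ a'.natAbs :
      ℕ → ℝ) : SeqGerm) := by
  rw [letterPairCoeff, map_mul, map_mul, map_pow, map_pow, ratGerm_simplePole,
    ratGerm_simplePole, map_intCast]
  rfl

theorem combGerm_shiftedWord (b : List {a : ℤ // a ≠ 0}) :
    combGerm (shiftedWord b) = germShift (wordGerm b) := by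
  obtain _ | ⟨⟨a, ha⟩, _ | ⟨⟨a', ha'⟩, b⟩⟩ := b
  · rw [shiftedWord, combGerm_single, map_one, one_mul]
    rfl
  · rw [shiftedWord, map_add, combGerm_single, combGerm_single, map_one, one_mul,
      ratGerm_letterCoeff, wordGerm, wordGerm, germShift_coe, ← Germ.coe_mul, ← Germ.coe_add,
      Germ.coe_eq]
    filter_upwards [eventually_ge_atTop 1] with n hn
    obtain ⟨m, rfl⟩ := Nat.exists_eq_add_of_le' hn
    have h1 := nestedS_cons_even ha [] m
    have h2 := nestedS_cons_odd ha [] m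
    simp only [Pi.add_apply, Pi.mul_apply, List.map_cons, List.map_nil, nestedS.eq_1,
      Nat.add_sub_cancel, mul_add, mul_one] at h1 h2 ⊢
    rw [h1, h2]
    push_cast
    ring_nf
  · rw [shiftedWord, map_add, map_add, combGerm_single, combGerm_single, combGerm_single, map_one,
      one_mul, ratGerm_letterCoeff, ratGerm_letterPairCoeff, wordGerm, wordGerm, wordGerm,
      germShift_coe, ← Germ.coe_mul, ← Germ.coe_mul, ← Germ.coe_add, ← Germ.coe_add, Germ.coe_eq]
    filter_upwards [eventually_ge_atTop 1] with n hn
    obtain ⟨m, rfl⟩ := Nat.exists_eq_add_of_le' hn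
    have h1 := nestedS_cons_even ha (a' :: b.map (↑)) m
    have h2 := nestedS_cons_odd ha (a' :: b.map (↑)) m
    have h3 := nestedS_cons_even ha' (b.map (↑)) m
    simp only [Pi.add_apply, Pi.mul_apply, List.map_cons, Nat.add_sub_cancel, mul_add,
      mul_one] at h1 h2 h3 ⊢
    rw [h1, h2, h3]
    push_cast
    ring_nf

theorem combGerm_twist (f : List {a : ℤ // a ≠ 0} →₀ RatFunc ℝ) :
    combGerm (twist (ratShift 2) shiftedWord f) = germShift (combGerm f) := by
  induction f using Finsupp.induction_linear with
  | zero => simp [twist]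
  | add f g hf hg =>
    rw [map_add, map_add, ← hf, ← hg, ← map_add]
    exact congrArg _ (Finsupp.sum_add_index' (by simp) (by simp [add_smul]))
  | single b r =>
    rw [twist, Finsupp.sum_single_index (by simp), combGerm_smul, combGerm_single, map_mul,
      combGerm_shiftedWord, ratGerm_ratShift]

/-- The nested sums at even arguments are linearly independent over the rational functions. -/
theorem eq_zero_of_combGerm_eq_zero {f : List {a : ℤ // a ≠ 0} →₀ RatFunc ℝ}
    (hf : combGerm f = 0) : f = 0 := by
  let R : Submodule (RatFunc ℝ) (List {a : ℤ // a ≠ 0} →₀ RatFunc ℝ) :=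
    { AddMonoidHom.ker combGerm with
      smul_mem' := fun r g hg => by
        have hg' : combGerm g = 0 := hg
        change combGerm (r • g) = 0
        rw [combGerm_smul, hg', mul_zero] }
  have hR : ∀ g, g ∈ R ↔ combGerm g = 0 := fun _ => Iff.rfl
  refine eq_zero_of_twist_mem (σ := ratShift 2) (α := fun a : {a : ℤ // a ≠ 0} => letterCoeff a) (e := shiftedWord)
    (R := R) shiftedWord_apply_of_length_le shiftedWord_cons_apply_of_length_eq
    (fun v h => eq_zero_of_ratShift_add_sum_eq) (fun g hg => ?_) ?_ ((hR f).2 hf)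
  · rw [hR] at hg ⊢
    rw [combGerm_twist, hg, map_zero]
  · rw [hR, combGerm_single, map_one, one_mul]
    exact one_ne_zero

/-- The rational combination of nested sums equal to `S_w(N) - S_w(N - 1)` for even `N`. -/
noncomputable def wordDiff : List {a : ℤ // a ≠ 0} → List {a : ℤ // a ≠ 0} →₀ RatFunc ℝ
  | [] => 0
  | a :: b => Finsupp.single b (simplePole 0 ^ a.1.natAbs)

theorem combGerm_wordDiff (w : List {a : ℤ // a ≠ 0}) : combGerm (wordDiff w) =
    ((fun n => nestedS (w.map (↑)) (2 * n) - nestedS (w.map (↑)) (2 * n - 1) : ℕ → ℝ) :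
      SeqGerm) := by
  obtain _ | ⟨⟨a, ha⟩, b⟩ := w
  · rw [wordDiff, map_zero]
    simp only [List.map_nil, nestedS.eq_1, sub_self]
    rfl
  · rw [wordDiff, combGerm_single, map_pow, ratGerm_simplePole, wordGerm, ← Germ.coe_pow,
      ← Germ.coe_mul, Germ.coe_eq]
    filter_upwards [eventually_ge_atTop 1] with n hn
    obtain ⟨m, rfl⟩ := Nat.exists_eq_add_of_le' hn
    have h1 := nestedS_cons_even ha (b.map (↑)) m
    have hm : 2 * (m + 1) - 1 = 2 * m + 1 := by omega
    simp only [Pi.pow_apply, Pi.mul_apply, List.map_cons, hm] at h1 ⊢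
    rw [mul_add, mul_one, h1]
    push_cast
    ring_nf

theorem sum_smul_wordDiff_apply (c : List {a : ℤ // a ≠ 0} →₀ ℝ) (b : List {a : ℤ // a ≠ 0}) :
    (c.sum fun w r => algebraMap ℝ (RatFunc ℝ) r • wordDiff w) b =
      aeval (simplePole 0) (letterPoly (fun _ => 1) (consCoeff c b)) := by
  classical
  induction c using Finsupp.induction_linear with
  | zero =>
    have : consCoeff (0 : List {a : ℤ // a ≠ 0} →₀ ℝ) b = 0 := by ext; simp
    simp [this, letterPoly]
  | add f g hf hg =>
    have : consCoeff (f + g) b = consCoeff f b + consCoeff g b := by ext; rfl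
    rw [Finsupp.sum_add_index' (by simp) (by simp [add_smul]), Finsupp.add_apply, hf, hg, this,
      letterPoly, letterPoly, letterPoly,
      Finsupp.sum_add_index' (by simp) (by simp [add_mul]), map_add]
  | single w r =>
    rw [Finsupp.sum_single_index (by simp), Finsupp.smul_apply, smul_eq_mul]
    obtain _ | ⟨a, u⟩ := w
    · have : consCoeff (Finsupp.single [] r) b = 0 := by ext; simp
      simp [this, letterPoly, wordDiff]
    · by_cases hub : b = u
      · have : consCoeff (Finsupp.single (a :: u) r) b = Finsupp.single a r := by
          ext a'
          simp [Finsupp.single_apply, hub]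
        rw [this, letterPoly, Finsupp.sum_single_index (by simp), wordDiff, hub]
        simp [RatFunc.algebraMap_eq_C]
      · have : consCoeff (Finsupp.single (a :: u) r) b = 0 := by
          ext a'
          simp [Ne.symm hub]
        simp [this, letterPoly, wordDiff, Finsupp.single_eq_of_ne hub]

theorem coeff_eq_neg_of_eventually_sum_eq_zero {c : List {a : ℤ // a ≠ 0} →₀ ℝ}
    (h : ∀ᶠ n : ℕ in atTop, (c.sum fun w r =>
      r * (nestedS (w.map (↑)) (2 * n) - nestedS (w.map (↑)) (2 * n - 1))) = 0)
    {a : ℤ} (ha : a ≠ 0) (b : List {a : ℤ // a ≠ 0}) :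
    c (⟨a, ha⟩ :: b) = -c (⟨-a, neg_ne_zero.2 ha⟩ :: b) := by
  have hgerm : combGerm (c.sum fun w r => algebraMap ℝ (RatFunc ℝ) r • wordDiff w) =
      Germ.coeRingHom atTop (∑ w ∈ c.support, fun n : ℕ =>
        c w * (nestedS (w.map (↑)) (2 * n) - nestedS (w.map (↑)) (2 * n - 1))) := by
    rw [Finsupp.sum, map_sum, map_sum]
    refine Finset.sum_congr rfl fun w _ => ?_
    rw [combGerm_smul, combGerm_wordDiff, ratGerm_algebraMap_real]
    rfl
  have hzero : combGerm (c.sum fun w r => algebraMap ℝ (RatFunc ℝ) r • wordDiff w) = 0 := by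
    rw [hgerm, Germ.coe_coeRingHom, ← Germ.coe_zero]
    refine Germ.coe_eq.2 ?_
    filter_upwards [h] with n hn
    rw [Finset.sum_apply]
    exact hn
  have hpoly : letterPoly (fun _ => 1) (consCoeff c b) = 0 := by
    refine eq_zero_of_aeval_simplePole_mem (y := 0) (coeff_zero_letterPoly _ _) ?_
    rw [← sum_smul_wordDiff_apply, eq_zero_of_combGerm_eq_zero hzero]
    exact zero_mem _
  have := coeff_natAbs_letterPoly (fun _ => 1) (consCoeff c b) ha
  rw [hpoly, coeff_zero, consCoeff_apply, consCoeff_apply] at this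
  linarith

theorem sum_nestedS_eq_of_antisymm {c : List ℤ →₀ ℝ}
    (hsupp : ∀ a ∈ c.support, a ≠ [] ∧ ∀ x ∈ a, x ≠ 0)
    (h : ∀ (a : ℤ), a ≠ 0 → ∀ (b : List ℤ), (∀ x ∈ b, x ≠ 0) → c (a :: b) = - c ((-a) :: b))
    (n : ℕ) :
    (∑ a ∈ c.support, c a * nestedS a (2 * n + 1)) =
      ∑ a ∈ c.support, c a * nestedS a (2 * n + 2) := by
  rw [← sub_eq_zero, ← Finset.sum_sub_distrib]
  have hcons : ∀ w ∈ c.support, ∃ a b, w = a :: b ∧ a ≠ 0 ∧ c (a :: b) = - c ((-a) :: b) := by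
    intro w hw
    obtain ⟨hne, h0⟩ := hsupp w hw
    obtain ⟨a, b, rfl⟩ := List.exists_cons_of_ne_nil hne
    simp only [List.mem_cons, forall_eq_or_imp] at h0
    exact ⟨a, b, rfl, h0.1, h a h0.1 b h0.2⟩
  refine Finset.sum_involution (fun w _ => w.modifyHead (-·)) (fun w hw => ?_) (fun w hw _ => ?_)
    (fun w hw => ?_) fun w hw => ?_
  · obtain ⟨a, b, rfl, ha, hab⟩ := hcons w hw
    simp only [List.modifyHead_cons]
    rw [nestedS_cons_even ha, nestedS_cons_even (neg_ne_zero.2 ha), Int.natAbs_neg, hab]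
    ring
  · obtain ⟨a, b, rfl, ha, hab⟩ := hcons w hw
    simp only [List.modifyHead_cons, ne_eq, List.cons.injEq, and_true]
    omega
  · obtain ⟨a, b, rfl, ha, hab⟩ := hcons w hw
    rw [Finsupp.mem_support_iff] at hw ⊢
    exact fun h0 => hw (by rw [hab, ← neg_zero]; exact congrArg _ h0)
  · obtain ⟨a, b, rfl, ha, hab⟩ := hcons w hw
    simp

end NestedSums

/-- Shift symmetry `S(2n+1) = S(2n+2)` for a finite linear combination
`S(n) = Σ_a c(a)·S_a(n)` of nested harmonic sums (over nonempty lists of nonzero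
integers) holds iff the coefficients satisfy `c((a)⌢b) = −c((−a)⌢b)`. -/
theorem shift_symmetry_odd_iff (c : List ℤ →₀ ℝ)
    (hsupp : ∀ a ∈ c.support, a ≠ [] ∧ ∀ x ∈ a, x ≠ 0) :
    (∀ n : ℕ, (∑ a ∈ c.support, c a * nestedS a (2 * n + 1)) =
        ∑ a ∈ c.support, c a * nestedS a (2 * n + 2)) ↔
      ∀ (a : ℤ), a ≠ 0 → ∀ (b : List ℤ), (∀ x ∈ b, x ≠ 0) →
        c (a :: b) = - c ((-a) :: b) := by
  refine ⟨fun h a ha b hb => ?_, sum_nestedS_eq_of_antisymm hsupp⟩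
  have hinj : Function.Injective (List.map ((↑) : {a : ℤ // a ≠ 0} → ℤ)) :=
    List.map_injective_iff.2 Subtype.val_injective
  have hrange : ∀ w : List ℤ, (∀ x ∈ w, x ≠ 0) →
      ∃ w' : List {a : ℤ // a ≠ 0}, w'.map (↑) = w := fun w hw => by
    lift w to List {a : ℤ // a ≠ 0} using hw
    exact ⟨w, rfl⟩
  obtain ⟨b, rfl⟩ := hrange b hb
  refine coeff_eq_neg_of_eventually_sum_eq_zero (c := c.comapDomain _ hinj.injOn) ?_ ha b
  filter_upwards [Filter.eventually_ge_atTop 1] with n hn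
  obtain ⟨m, rfl⟩ := Nat.exists_eq_add_of_le' hn
  have hbij : Set.BijOn (List.map ((↑) : {a : ℤ // a ≠ 0} → ℤ))
      (List.map ((↑) : {a : ℤ // a ≠ 0} → ℤ) ⁻¹' c.support) c.support := by
    refine ⟨fun _ hw => hw, hinj.injOn, fun w hw => ?_⟩
    obtain ⟨w', rfl⟩ := hrange w (hsupp w hw).2
    exact ⟨w', hw, rfl⟩
  have hm : 2 * (m + 1) - 1 = 2 * m + 1 := by omega
  have := Finsupp.sum_comapDomain (List.map ((↑) : {a : ℤ // a ≠ 0} → ℤ)) c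
    (fun w r => r * (nestedS w (2 * (m + 1)) - nestedS w (2 * (m + 1) - 1))) hbij
  refine this.trans ?_
  simp only [Finsupp.sum, mul_sub, Finset.sum_sub_distrib, hm]
  exact sub_eq_zero.2 (h m).symm
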